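/- Let X be a complex m×n matrix. Then the bilinear Schur factorization of X is unique: if (T, W, G) and (T', W', G') are both bilinear Schur factorizations of X, then T = T', W = W' and G = G'. -/

import Mathlib

open Matrix
open scoped ComplexOrder

noncomputable section

namespace MatFact

/-- ℓ² norm of a complex vector. -/
def vnorm {n : ℕ} (v : Fin n → ℂ) : ℝ := Real.sqrt (∑ j, ‖v j‖ ^ 2)

/-- Operator norm of a matrix as a map ℓ²(Fin n) → ℓ²(Fin m). -/
def opNorm {m n : ℕ} (X : Matrix (Fin m) (Fin n) ℂ) : ℝ :=
  sSup {c : ℝ | ∃ v : Fin n → ℂ, vnorm v ≤ 1 ∧ c = vnorm (X.mulVec v)}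

/-- Column norm: the maximal ℓ² norm of a column. -/
def colNorm {m n : ℕ} (X : Matrix (Fin m) (Fin n) ℂ) : ℝ :=
  ⨆ j : Fin n, vnorm (fun i => X i j)

/-- Hilbert–Schmidt (Frobenius) norm. -/
def frobNorm {m n : ℕ} (X : Matrix (Fin m) (Fin n) ℂ) : ℝ :=
  Real.sqrt (∑ i, ∑ j, ‖X i j‖ ^ 2)

/-- Schur norm: operator norm of Schur (entrywise) multiplication by `X`
on matrices with the operator norm. -/
def schurNorm {m n : ℕ} (X : Matrix (Fin m) (Fin n) ℂ) : ℝ :=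
  sSup {c : ℝ | ∃ A : Matrix (Fin m) (Fin n) ℂ, opNorm A ≤ 1 ∧
    c = opNorm (Matrix.hadamard X A)}

/-- The T-norm (bilinear Schur norm). -/
def Tnorm {m n : ℕ} (X : Matrix (Fin m) (Fin n) ℂ) : ℝ :=
  sSup {c : ℝ | ∃ (a : Fin m → ℂ) (B : Matrix (Fin m) (Fin n) ℂ),
    (∀ i, ‖a i‖ ≤ 1) ∧ opNorm B ≤ 1 ∧
    c = vnorm (fun j => ∑ i, a i * X i j * B i j)}

/-- The F-norm: operator norm of `X` from `ℂⁿ` with the sup norm to `ℂᵐ`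
with the ℓ² norm. -/
def Fnorm {m n : ℕ} (X : Matrix (Fin m) (Fin n) ℂ) : ℝ :=
  sSup {c : ℝ | ∃ v : Fin n → ℂ, (∀ j, ‖v j‖ ≤ 1) ∧ c = vnorm (X.mulVec v)}

/-- The bilinear form norm. -/
def Bnorm {m n : ℕ} (Y : Matrix (Fin m) (Fin n) ℂ) : ℝ :=
  sSup {c : ℝ | ∃ (a : Fin m → ℂ) (b : Fin n → ℂ), (∀ i, ‖a i‖ ≤ 1) ∧
    (∀ j, ‖b j‖ ≤ 1) ∧ c = ‖∑ i, ∑ j, Y i j * a i * b j‖}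

/-- The completely bounded F-norm. -/
def cbF {m n : ℕ} (X : Matrix (Fin m) (Fin n) ℂ) : ℝ :=
  sInf {c : ℝ | ∃ (A : Matrix (Fin m) (Fin n) ℂ) (ξ : Fin n → ℂ),
    X = A * Matrix.diagonal ξ ∧ c = opNorm A * vnorm ξ}

/-- The completely bounded bilinear form norm. -/
def cbB {m n : ℕ} (X : Matrix (Fin m) (Fin n) ℂ) : ℝ :=
  sInf {c : ℝ | ∃ (η : Fin m → ℂ) (B : Matrix (Fin m) (Fin n) ℂ) (ξ : Fin n → ℂ),
    X = Matrix.diagonal η * B * Matrix.diagonal ξ ∧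
    c = vnorm η * opNorm B * vnorm ξ}

/-- The range (column space) of a matrix, as a submodule of `ℂᵐ`. -/
def ran {m n : ℕ} (X : Matrix (Fin m) (Fin n) ℂ) : Submodule ℂ (Fin m → ℂ) :=
  LinearMap.range X.mulVecLin

/-- `P` is the orthogonal projection onto the subspace `E`, i.e. `P` is a
Hermitian idempotent with range `E`. -/
def IsOrthProjOnto {n : ℕ} (P : Matrix (Fin n) (Fin n) ℂ)
    (E : Submodule ℂ (Fin n → ℂ)) : Prop :=
  P.IsHermitian ∧ P * P = P ∧ ran P = E

/-- `W` is a partial isometry with support `E` and range `F`. -/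
def IsPartialIsometryFromTo {m n : ℕ} (W : Matrix (Fin m) (Fin n) ℂ)
    (E : Submodule ℂ (Fin n → ℂ)) (F : Submodule ℂ (Fin m → ℂ)) : Prop :=
  IsOrthProjOnto (Wᴴ * W) E ∧ IsOrthProjOnto (W * Wᴴ) F

/-- A cb operator factorization of `X`. -/
def IsCbOpFact {m n : ℕ} (X A : Matrix (Fin m) (Fin n) ℂ) (ξ : Fin n → ℂ) : Prop :=
  (∀ j, 0 ≤ ξ j) ∧ vnorm ξ = 1 ∧ opNorm A = cbF X ∧
  (∀ j, ξ j = 0 → ∀ i, A i j = 0) ∧ X = A * Matrix.diagonal ξ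

/-- A cb bilinear form factorization of `X`. -/
def IsCbBilFact {m n : ℕ} (X : Matrix (Fin m) (Fin n) ℂ) (η : Fin m → ℂ)
    (B : Matrix (Fin m) (Fin n) ℂ) (ξ : Fin n → ℂ) : Prop :=
  (∀ i, 0 ≤ η i) ∧ (∀ j, 0 ≤ ξ j) ∧ vnorm η = 1 ∧ vnorm ξ = 1 ∧
  opNorm B = cbB X ∧ (∀ j, ξ j = 0 → ∀ i, B i j = 0) ∧
  (∀ i, η i = 0 → ∀ j, B i j = 0) ∧ X = Matrix.diagonal η * B * Matrix.diagonal ξ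

/-- A Schur factorization of `X`. -/
def IsSchurFact {m n : ℕ} (X : Matrix (Fin m) (Fin n) ℂ)
    (F : Matrix (Fin m) (Fin m) ℂ) (W : Matrix (Fin m) (Fin n) ℂ)
    (G : Matrix (Fin n) (Fin n) ℂ) : Prop :=
  F.PosSemidef ∧ (∀ i, (F * F) i i ≤ 1) ∧ G.PosSemidef ∧ (∀ j, (G * G) j j ≤ 1) ∧
  IsPartialIsometryFromTo W (ran G) (ran F) ∧
  X = (schurNorm X : ℂ) • (F * W * G)

/-- A bilinear Schur factorization of `X`. -/
def IsBilinSchurFact {m n : ℕ} (X : Matrix (Fin m) (Fin n) ℂ)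
    (T : Matrix (Fin m) (Fin m) ℂ) (W : Matrix (Fin m) (Fin n) ℂ)
    (G : Matrix (Fin n) (Fin n) ℂ) : Prop :=
  T.PosSemidef ∧ frobNorm T = Tnorm X ∧ G.PosSemidef ∧ (∀ j, (G * G) j j ≤ 1) ∧
  IsPartialIsometryFromTo W (ran G) (ran T) ∧ X = T * W * G

/-- Maximal diagonal entry (real part) of a square matrix. -/
def maxDiag {n : ℕ} (P : Matrix (Fin n) (Fin n) ℂ) : ℝ := ⨆ i, (P i i).re

end MatFact

namespace MatFact

section OperatorNorm

open scoped Matrix.Norms.L2Operator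

lemma vnorm_eq_norm_toLp {n : ℕ} (v : Fin n → ℂ) : vnorm v = ‖WithLp.toLp 2 v‖ := by
  simp [vnorm, EuclideanSpace.norm_eq]

lemma vnorm_sq {n : ℕ} (v : Fin n → ℂ) : vnorm v ^ 2 = ∑ j, ‖v j‖ ^ 2 :=
  Real.sq_sqrt (by positivity)

lemma opNorm_eq_l2_opNorm {m n : ℕ} (B : Matrix (Fin m) (Fin n) ℂ) : opNorm B = ‖B‖ := by
  rw [l2_opNorm_def, ← ContinuousLinearMap.sSup_unitClosedBall_eq_norm, opNorm]
  congr 1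
  ext c
  simp only [Set.mem_ofPred_eq, Set.mem_image, mem_closedBall_zero_iff]
  constructor
  · rintro ⟨v, hv, rfl⟩
    exact ⟨WithLp.toLp 2 v, by rwa [← vnorm_eq_norm_toLp], by rw [vnorm_eq_norm_toLp]; rfl⟩
  · rintro ⟨v, hv, rfl⟩
    exact ⟨v.ofLp, by rwa [vnorm_eq_norm_toLp], by rw [vnorm_eq_norm_toLp]; rfl⟩

lemma sum_norm_sq_vecMul_le {m n : ℕ} {B : Matrix (Fin m) (Fin n) ℂ} (hB : opNorm B ≤ 1)
    (u : Fin m → ℂ) : ∑ j, ‖(u ᵥ* B) j‖ ^ 2 ≤ ∑ i, ‖u i‖ ^ 2 := by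
  rw [opNorm_eq_l2_opNorm, ← l2_opNorm_conjTranspose] at hB
  have h := l2_opNorm_mulVec Bᴴ (WithLp.toLp 2 (star u))
  have h' : vnorm (Bᴴ *ᵥ star u) ≤ vnorm (star u) := by
    rw [vnorm_eq_norm_toLp, vnorm_eq_norm_toLp]
    exact h.trans (mul_le_of_le_one_left (norm_nonneg _) hB)
  have h2 := pow_le_pow_left₀ (Real.sqrt_nonneg _) h' 2
  rw [← star_vecMul] at h2
  change vnorm _ ^ 2 ≤ vnorm _ ^ 2 at h2
  rw [vnorm_sq, vnorm_sq] at h2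
  simpa using h2

end OperatorNorm

lemma trace_mul_conjTranspose_re {m n : Type*} [Fintype m] [Fintype n] (A : Matrix m n ℂ) :
    (A * Aᴴ).trace.re = ∑ i, ∑ j, ‖A i j‖ ^ 2 := by
  simp [trace, mul_apply, Complex.mul_conj, Complex.normSq_eq_norm_sq, -Complex.ofReal_pow]

lemma frobNorm_sq {m n : ℕ} (A : Matrix (Fin m) (Fin n) ℂ) :
    frobNorm A ^ 2 = (A * Aᴴ).trace.re := by
  rw [trace_mul_conjTranspose_re]
  exact Real.sq_sqrt (by positivity)

lemma Tnorm_mul_sq_le {m n : ℕ} {k : Type*} [Fintype k] (A : Matrix (Fin m) k ℂ)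
    (C : Matrix k (Fin n) ℂ) {c : ℝ} (hc : 0 ≤ c) (hC : ∀ j, ((Cᴴ * C) j j).re ≤ c) :
    Tnorm (A * C) ^ 2 ≤ c * (A * Aᴴ).trace.re := by
  have hnn : 0 ≤ c * (A * Aᴴ).trace.re := by
    rw [trace_mul_conjTranspose_re]; positivity
  have hcol (j : Fin n) : ∑ l, ‖C l j‖ ^ 2 ≤ c := by
    refine le_of_eq_of_le ?_ (hC j)
    simp [mul_apply, ← Complex.normSq_eq_conj_mul_self, Complex.normSq_eq_norm_sq,
      -Complex.ofReal_pow]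
  have hle : Tnorm (A * C) ≤ √(c * (A * Aᴴ).trace.re) := by
    refine Real.sSup_le ?_ (Real.sqrt_nonneg _)
    rintro _ ⟨a, B, ha, hB, rfl⟩
    refine Real.sqrt_le_sqrt ?_
    have hentry (j : Fin n) : ‖∑ i, a i * (A * C) i j * B i j‖ ^ 2 ≤
        c * ∑ l, ‖((fun i => a i * A i l) ᵥ* B) j‖ ^ 2 := by
      have he : ∑ i, a i * (A * C) i j * B i j =
          ∑ l, C l j * ((fun i => a i * A i l) ᵥ* B) j := by
        simp only [mul_apply, vecMul, dotProduct, Finset.mul_sum, Finset.sum_mul]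
        rw [Finset.sum_comm]
        refine Finset.sum_congr rfl fun l _ => Finset.sum_congr rfl fun i _ => ?_
        ring
      calc ‖∑ i, a i * (A * C) i j * B i j‖ ^ 2
          ≤ (∑ l, ‖C l j‖ * ‖((fun i => a i * A i l) ᵥ* B) j‖) ^ 2 := by
            rw [he]
            gcongr
            exact norm_sum_le_of_le _ fun l _ => (norm_mul _ _).le
        _ ≤ (∑ l, ‖C l j‖ ^ 2) * ∑ l, ‖((fun i => a i * A i l) ᵥ* B) j‖ ^ 2 :=
            Finset.sum_mul_sq_le_sq_mul_sq _ _ _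
        _ ≤ _ := by
            gcongr
            exact hcol j
    calc ∑ j, ‖∑ i, a i * (A * C) i j * B i j‖ ^ 2
        ≤ ∑ j, c * ∑ l, ‖((fun i => a i * A i l) ᵥ* B) j‖ ^ 2 :=
          Finset.sum_le_sum fun j _ => hentry j
      _ = c * ∑ l, ∑ j, ‖((fun i => a i * A i l) ᵥ* B) j‖ ^ 2 := by
          rw [← Finset.mul_sum, Finset.sum_comm]
      _ ≤ c * ∑ l, ∑ i, ‖A i l‖ ^ 2 := by
          gcongr with l
          refine (sum_norm_sq_vecMul_le hB _).trans (Finset.sum_le_sum fun i _ => ?_)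
          rw [norm_mul]
          gcongr
          exact mul_le_of_le_one_left (norm_nonneg _) (ha i)
      _ = c * (A * Aᴴ).trace.re := by rw [trace_mul_conjTranspose_re, Finset.sum_comm]
  have h0 : 0 ≤ Tnorm (A * C) := by
    refine Real.sSup_nonneg ?_
    rintro _ ⟨a, B, -, -, rfl⟩
    exact Real.sqrt_nonneg _
  calc Tnorm (A * C) ^ 2 ≤ √(c * (A * Aᴴ).trace.re) ^ 2 := pow_le_pow_left₀ h0 hle 2
    _ = _ := Real.sq_sqrt hnn

lemma exists_eq_mul_of_ran_le {m n p : ℕ} {A : Matrix (Fin m) (Fin n) ℂ}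
    {B : Matrix (Fin m) (Fin p) ℂ} (h : ran A ≤ ran B) :
    ∃ S : Matrix (Fin p) (Fin n) ℂ, A = B * S := by
  have hx (j : Fin n) : ∃ v, B *ᵥ v = A.col j := by
    have : A.col j ∈ ran B := h ⟨Pi.single j 1, by simp⟩
    simpa [ran] using this
  choose f hf using hx
  refine ⟨(Matrix.of f)ᵀ, ?_⟩
  ext i j
  have := congrFun (hf j) i
  simpa [mulVec, dotProduct, Matrix.mul_apply] using this.symm

lemma IsOrthProjOnto.exists_mul_eq {n : ℕ} {P Y : Matrix (Fin n) (Fin n) ℂ}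
    (hP : IsOrthProjOnto P (ran Y)) (hY : Yᴴ = Y) :
    P * Y = Y ∧ ∃ S : Matrix (Fin n) (Fin n) ℂ, P = Y * S ∧ P = Sᴴ * Y := by
  obtain ⟨h1, h2, h3⟩ := hP
  obtain ⟨S, hS⟩ := exists_eq_mul_of_ran_le h3.le
  obtain ⟨R, hR⟩ := exists_eq_mul_of_ran_le h3.ge
  refine ⟨by rw [hR, ← Matrix.mul_assoc, h2], S, hS, ?_⟩
  rw [← h1.eq, hS, conjTranspose_mul, hY]

lemma IsOrthProjOnto.eq {n : ℕ} {P Q : Matrix (Fin n) (Fin n) ℂ} {E : Submodule ℂ (Fin n → ℂ)}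
    (hP : IsOrthProjOnto P E) (hQ : IsOrthProjOnto Q E) : P = Q := by
  have h1 : Q * P = P := ((hP.2.2 ▸ hQ).exists_mul_eq hP.1).1
  have h2 : P * Q = Q := ((hQ.2.2 ▸ hP).exists_mul_eq hQ.1).1
  have h3 := congrArg conjTranspose h1
  rw [conjTranspose_mul, hP.1.eq, hQ.1.eq, h2] at h3
  exact h3.symm

lemma mul_conjTranspose_mul_self_of_idem {m n : ℕ} {W : Matrix (Fin m) (Fin n) ℂ}
    (h : Wᴴ * W * (Wᴴ * W) = Wᴴ * W) : W * (Wᴴ * W) = W := by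
  have h0 : Wᴴ * W * (Wᴴ * W - 1) = 0 := by rw [Matrix.mul_sub, h]; simp
  rw [conjTranspose_mul_self_mul_eq_zero, Matrix.mul_sub, Matrix.mul_one] at h0
  exact sub_eq_zero.1 h0

lemma exists_conjTranspose_mul_self_mul_eq {k n p : Type*} [Fintype k] [Fintype n]
    [DecidableEq k] (C : Matrix k n ℂ) (D : Matrix k p ℂ) :
    ∃ Z : Matrix n p ℂ, Cᴴ * C * Z = Cᴴ * D := by
  have hr : LinearMap.range (Cᴴ * C).mulVecLin = LinearMap.range Cᴴ.mulVecLin := by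
    apply Submodule.eq_of_le_of_finrank_eq
    · rw [mulVecLin_mul]; exact LinearMap.range_comp_le_range _ _
    · exact (rank_conjTranspose_mul_self C).trans (rank_conjTranspose C).symm
  have hx (j : p) : ∃ v, (Cᴴ * C) *ᵥ v = Cᴴ *ᵥ D.col j := by
    have : Cᴴ *ᵥ D.col j ∈ LinearMap.range (Cᴴ * C).mulVecLin := hr ▸ ⟨D.col j, rfl⟩
    simpa using this
  choose f hf using hx
  refine ⟨(Matrix.of f)ᵀ, ?_⟩
  ext i j
  exact congrFun (hf j) i

/-- If the factorization `A * C` is optimal for the T-norm then the columns of `Aᴴ` lie in the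
range of `C`. -/
lemma exists_conjTranspose_eq_mul_of_le_Tnorm {m n : ℕ} {k : Type*} [Fintype k] [DecidableEq k]
    (A : Matrix (Fin m) k ℂ) (C : Matrix k (Fin n) ℂ) {c : ℝ} (hc : 0 < c)
    (hC : ∀ j, ((Cᴴ * C) j j).re ≤ c) (h : c * (A * Aᴴ).trace.re ≤ Tnorm (A * C) ^ 2) :
    ∃ Z : Matrix (Fin n) (Fin m) ℂ, Aᴴ = C * Z := by
  obtain ⟨Z, hZ⟩ := exists_conjTranspose_mul_self_mul_eq C Aᴴ
  refine ⟨Z, ?_⟩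
  set N := Aᴴ - C * Z with hN
  have hA : A = Nᴴ + (C * Z)ᴴ := by rw [hN]; simp
  have hCN : Cᴴ * N = 0 := by rw [hN, Matrix.mul_sub, ← Matrix.mul_assoc, hZ, sub_self]
  have hNC : Nᴴ * C = 0 := by simpa using congrArg conjTranspose hCN
  have hX : A * C = (C * Z)ᴴ * C := by
    conv_lhs => rw [hA, Matrix.add_mul, hNC, zero_add]
  have hAA : A * Aᴴ = Nᴴ * N + (C * Z)ᴴ * (C * Z) := by
    have h1 : Nᴴ * (C * Z) = 0 := by rw [← Matrix.mul_assoc, hNC, Matrix.zero_mul]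
    have h2 : (C * Z)ᴴ * N = 0 := by
      rw [conjTranspose_mul, Matrix.mul_assoc, hCN, Matrix.mul_zero]
    have h3 : Aᴴ = N + C * Z := by rw [hN]; simp
    rw [h3, hA]
    simp only [Matrix.add_mul, Matrix.mul_add, h1, h2]
    simp
  have hle := Tnorm_mul_sq_le (C * Z)ᴴ C hc.le hC
  rw [← hX] at hle
  have h2 := h.trans hle
  rw [hAA, trace_add, Complex.add_re, conjTranspose_conjTranspose, mul_add] at h2
  have h3 : (Nᴴ * N).trace.re ≤ 0 := by nlinarith
  have h4 : 0 ≤ (Nᴴ * N).trace := (posSemidef_conjTranspose_mul_self N).trace_nonneg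
  have h5 : (Nᴴ * N).trace = 0 := by
    rw [Complex.le_def] at h4
    apply Complex.ext
    · exact le_antisymm h3 h4.1
    · exact h4.2.symm
  rw [trace_conjTranspose_mul_self_eq_zero_iff] at h5
  exact sub_eq_zero.1 h5

open scoped MatrixOrder Matrix.Norms.L2Operator in
lemma eq_of_posSemidef_of_mul_self_eq {n : ℕ} {A B : Matrix (Fin n) (Fin n) ℂ}
    (hA : A.PosSemidef) (hB : B.PosSemidef) (h : A * A = B * B) : A = B := by
  exact (CFC.sqrt_mul_self A hA.nonneg).symm.trans (h ▸ CFC.sqrt_mul_self B hB.nonneg)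

/-- A product `T * W * G` and its right factor `G` have the same right annihilator, when `W` is a
partial isometry from the range of `G` onto the range of `T`. -/
lemma mul_mul_mul_eq_zero_iff {m n p : ℕ} {T : Matrix (Fin m) (Fin m) ℂ}
    {W : Matrix (Fin m) (Fin n) ℂ} {G : Matrix (Fin n) (Fin n) ℂ} (hT : Tᴴ = T) (hG : Gᴴ = G)
    (hW : IsPartialIsometryFromTo W (ran G) (ran T)) (Y : Matrix (Fin n) (Fin p) ℂ) :
    T * W * G * Y = 0 ↔ G * Y = 0 := by
  refine ⟨fun h => ?_, fun h => by rw [Matrix.mul_assoc, h, Matrix.mul_zero]⟩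
  obtain ⟨h1, -⟩ := hW.1.exists_mul_eq hG
  obtain ⟨-, S, -, hS⟩ := hW.2.exists_mul_eq hT
  have hWW : Wᴴ * W * (Wᴴ * W) = Wᴴ * W := hW.1.2.1
  calc G * Y = Wᴴ * (W * Wᴴ) * W * G * Y := by
        rw [← Matrix.mul_assoc, Matrix.mul_assoc _ Wᴴ W, hWW, h1]
    _ = Wᴴ * Sᴴ * (T * W * G * Y) := by rw [hS]; simp only [Matrix.mul_assoc]
    _ = 0 := by rw [h, Matrix.mul_zero]

/-- Optimality of two factorizations forces their left factors to be simultaneously of the form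
`G * Z`. -/
lemma IsBilinSchurFact.exists_common_factor {m n : ℕ} {X : Matrix (Fin m) (Fin n) ℂ}
    {T T' : Matrix (Fin m) (Fin m) ℂ} {W W' : Matrix (Fin m) (Fin n) ℂ}
    {G G' : Matrix (Fin n) (Fin n) ℂ}
    (h : IsBilinSchurFact X T W G) (h' : IsBilinSchurFact X T' W' G') :
    ∃ Z : Matrix (Fin n) (Fin m) ℂ, Wᴴ * T = G * Z ∧ W'ᴴ * T' = G' * Z := by
  obtain ⟨hT, hTn, hG, hGd, hW, hX⟩ := h
  obtain ⟨hT', hTn', hG', hGd', hW', hX'⟩ := h'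
  have htr {T : Matrix (Fin m) (Fin m) ℂ} {W : Matrix (Fin m) (Fin n) ℂ}
      {G : Matrix (Fin n) (Fin n) ℂ} (hT : T.PosSemidef) (hTn : frobNorm T = Tnorm X)
      (hW : IsPartialIsometryFromTo W (ran G) (ran T)) :
      (T * W * (T * W)ᴴ).trace.re = Tnorm X ^ 2 := by
    rw [← hTn, frobNorm_sq, conjTranspose_mul, Matrix.mul_assoc, ← Matrix.mul_assoc W,
      hT.1.eq, (hW.2.exists_mul_eq hT.1).1]
  have hAC : fromCols (T * W) (T' * W') * ((1 / 2 : ℝ) • fromRows G G') = X := by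
    rw [Matrix.mul_smul, fromCols_mul_fromRows, ← hX, ← hX', ← two_smul ℝ X, smul_smul]
    norm_num
  obtain ⟨Z, hZ⟩ := exists_conjTranspose_eq_mul_of_le_Tnorm (c := 1 / 2)
    (fromCols (T * W) (T' * W')) ((1 / 2 : ℝ) • fromRows G G') (by norm_num)
    (fun j => by
      have h1 := (Complex.le_def.1 (hGd j)).1
      have h2 := (Complex.le_def.1 (hGd' j)).1
      simp only [conjTranspose_smul, conjTranspose_fromRows_eq_fromCols_conjTranspose,
        Matrix.smul_mul, Matrix.mul_smul, fromCols_mul_fromRows, hG.1.eq, hG'.1.eq]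
      simp at h1 h2 ⊢
      linarith)
    (by
      rw [hAC, conjTranspose_fromCols_eq_fromRows_conjTranspose, fromCols_mul_fromRows, trace_add,
        Complex.add_re, htr hT hTn hW, htr hT' hTn' hW']
      linarith)
  refine ⟨(1 / 2 : ℝ) • Z, ?_⟩
  rw [conjTranspose_fromCols_eq_fromRows_conjTranspose, Matrix.smul_mul, ← Matrix.mul_smul,
    fromRows_mul, fromRows_inj.eq_iff] at hZ
  simpa [hT.1.eq, hT'.1.eq] using hZ

theorem stmt13 {m n : ℕ} (X : Matrix (Fin m) (Fin n) ℂ)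
    (T T' : Matrix (Fin m) (Fin m) ℂ) (W W' : Matrix (Fin m) (Fin n) ℂ)
    (G G' : Matrix (Fin n) (Fin n) ℂ)
    (hfact : IsBilinSchurFact X T W G) (hfact' : IsBilinSchurFact X T' W' G') :
    T = T' ∧ W = W' ∧ G = G' := by
  obtain ⟨Z, hZ, hZ'⟩ := hfact.exists_common_factor hfact'
  obtain ⟨hT, -, hG, -, hW, hX⟩ := hfact
  obtain ⟨hT', -, hG', -, hW', hX'⟩ := hfact'
  have hGZ : G * G * Z = G' * G' * Z := by
    have h1 : G * G * Z = Xᴴ := by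
      rw [Matrix.mul_assoc, ← hZ, hX]
      simp [hT.1.eq, hG.1.eq, Matrix.mul_assoc]
    have h2 : G' * G' * Z = Xᴴ := by
      rw [Matrix.mul_assoc, ← hZ', hX']
      simp [hT'.1.eq, hG'.1.eq, Matrix.mul_assoc]
    rw [h1, h2]
  obtain ⟨hPG, -⟩ := hW.1.exists_mul_eq hG.1
  obtain ⟨hFT, S, hS, hS'⟩ := hW.2.exists_mul_eq hT.1
  obtain ⟨hFT', -⟩ := hW'.2.exists_mul_eq hT'.1
  have hWW := mul_conjTranspose_mul_self_of_idem hW.1.2.1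
  have hWW' := mul_conjTranspose_mul_self_of_idem hW'.1.2.1
  have hGR : G * (1 - Z * (S * W * G)) = 0 := by
    have : G * (Z * (S * W * G)) = G := by
      calc G * (Z * (S * W * G)) = Wᴴ * (T * S) * W * G := by
            rw [← Matrix.mul_assoc, ← hZ]; simp only [Matrix.mul_assoc]
        _ = Wᴴ * (W * (Wᴴ * W)) * G := by rw [← hS]; simp only [Matrix.mul_assoc]
        _ = G := by rw [hWW, hPG]
    rw [Matrix.mul_sub, this, Matrix.mul_one, sub_self]
  have hGR' : G' * (1 - Z * (S * W * G)) = 0 := by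
    rw [← mul_mul_mul_eq_zero_iff hT'.1 hG'.1 hW', ← hX', hX,
      mul_mul_mul_eq_zero_iff hT.1 hG.1 hW, hGR]
  have hGG : G = G' := by
    refine eq_of_posSemidef_of_mul_self_eq hG hG' ?_
    have h1 : G * G = G * G * Z * (S * W * G) := by
      have := congrArg (G * ·) hGR
      simp only [Matrix.mul_sub, Matrix.mul_zero, Matrix.mul_one] at this
      simpa only [Matrix.mul_assoc] using sub_eq_zero.1 this
    have h2 : G' * G' = G' * G' * Z * (S * W * G) := by
      have := congrArg (G' * ·) hGR'
      simp only [Matrix.mul_sub, Matrix.mul_zero, Matrix.mul_one] at this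
      simpa only [Matrix.mul_assoc] using sub_eq_zero.1 this
    rw [h1, h2, hGZ]
  subst hGG
  have hWT : Wᴴ * T = W'ᴴ * T' := hZ.trans hZ'.symm
  have hTW : T * W = T' * W' := by
    simpa [hT.1.eq, hT'.1.eq] using congrArg conjTranspose hWT
  have hTT : T = T' := by
    refine eq_of_posSemidef_of_mul_self_eq hT hT' ?_
    calc T * T = T * W * (Wᴴ * T) := by
          rw [Matrix.mul_assoc, ← Matrix.mul_assoc W, hFT]
      _ = T' * W' * (W'ᴴ * T') := by rw [hTW, hWT]
      _ = T' * T' := by rw [Matrix.mul_assoc, ← Matrix.mul_assoc W', hFT']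
  subst hTT
  refine ⟨rfl, ?_, rfl⟩
  calc W = W * Wᴴ * W := by rw [Matrix.mul_assoc, hWW]
    _ = W * Wᴴ * W' := by rw [hS', Matrix.mul_assoc, hTW, Matrix.mul_assoc]
    _ = W' * W'ᴴ * W' := by rw [hW.2.eq hW'.2]
    _ = W' := by rw [Matrix.mul_assoc, hWW']

end MatFact
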